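/- Let m₁ ≥ m₂ ≥ … ≥ m_l ≥ 0 be integers and set v := Γ^{+,m₁−m₂}_1 Γ^{+,m₂−m₃}_2 ⋯ Γ^{+,m_{l−1}−m_l}_{l−1} Γ^{+,m_l}_l |0⟩ ∈ F. Then: (a) Ê_{ab} v = 0 for all a < b; (b) ê*^{pq} v = 0 for all p < q, and ê**^{pq} v = 0 for all 1 ≤ p, q ≤ l; (c) ê*^{pp} v = −m_p·v for all p; (d) (Ê_{kk} − Ê_{1−k,1−k}) v = m_k·v for all k ≥ 1, where m_k := 0 for k > l. -/

import Mathlib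

/-!
Bosonic Fock space of `l` pairs of bosonic ghost fields indexed by `½ + ℤ`.

The Fock space `BFock l` is the polynomial algebra `ℂ[x^{ε,p}_r]` with
`ε ∈ {+,-}` (encoded as `Bool`, `true = +`), `1 ≤ p ≤ l` (encoded as `Fin l`) and
`r ∈ ½+ℤ`, `r > 0` (encoded as `n : ℕ` with `r = n + ½`), with vacuum `|0⟩ = 1`.

For `r > 0`, `γ^{ε,p}_{-r}` is multiplication by `x^{ε,p}_r`, while
`γ^{+,p}_{r} = ∂/∂x^{-,p}_r` and `γ^{-,p}_{r} = -∂/∂x^{+,p}_r`.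
A general mode `γ^{ε,p}_{k-½}` is encoded by `boson ε p k` for `k : ℤ`.
-/

noncomputable section

/-- Variable index: `(ε, p, n)` corresponds to `x^{ε,p}_{n+½}`. -/
abbrev BBas (l : ℕ) := Bool × Fin l × ℕ

/-- The bosonic Fock space: the polynomial algebra on the variables `x^{ε,p}_r`. -/
abbrev BFock (l : ℕ) := MvPolynomial (BBas l) ℂ

/-- The vacuum vector `|0⟩ = 1`. -/
def bvac (l : ℕ) : BFock l := 1

/-- Creation operator `γ^{ε,p}_{-(n+½)}`: multiplication by `x^{ε,p}_{n+½}`. -/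
def gamCr (l : ℕ) (ε : Bool) (p : Fin l) (n : ℕ) : BFock l → BFock l :=
  fun f => MvPolynomial.X ((ε, p, n) : BBas l) * f

/-- Annihilation operator: `γ^{+,p}_{n+½} = ∂/∂x^{-,p}_{n+½}` and
`γ^{-,p}_{n+½} = -∂/∂x^{+,p}_{n+½}`. -/
def gamAn (l : ℕ) (ε : Bool) (p : Fin l) (n : ℕ) : BFock l → BFock l :=
  if ε then fun f => MvPolynomial.pderiv ((false, p, n) : BBas l) f
  else fun f => -(MvPolynomial.pderiv ((true, p, n) : BBas l) f)

/-- `boson ε p k` is the mode `γ^{ε,p}_{k-½}`, for `k : ℤ`. -/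
def boson (l : ℕ) (ε : Bool) (p : Fin l) (k : ℤ) : BFock l → BFock l :=
  if k ≤ 0 then gamCr l ε p (-k).toNat else gamAn l ε p (k - 1).toNat

/-- Normal ordered product `:γ^{ε₁,p₁}_{k₁-½} γ^{ε₂,p₂}_{k₂-½}:`, which is `γ₂ γ₁` if
`k₁ - ½ > 0 > k₂ - ½` and `γ₁ γ₂` otherwise. -/
def nGam (l : ℕ) (ε₁ : Bool) (p₁ : Fin l) (k₁ : ℤ) (ε₂ : Bool) (p₂ : Fin l) (k₂ : ℤ) :
    BFock l → BFock l :=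
  if 1 ≤ k₁ ∧ k₂ ≤ 0 then fun x => boson l ε₂ p₂ k₂ (boson l ε₁ p₁ k₁ x)
  else fun x => boson l ε₁ p₁ k₁ (boson l ε₂ p₂ k₂ x)

/-- `Ê_{ij} = -Σ_{p=1}^{l} :γ^{+,p}_{½-i} γ^{-,p}_{j-½}:`. -/
def bEhat (l : ℕ) (i j : ℤ) : BFock l → BFock l :=
  fun x => -(∑ p : Fin l, nGam l true p (1 - i) false p j x)

/-- `ê*^{pq} = Σ_{r∈½+ℤ} :γ^{+,p}_{-r} γ^{-,q}_{r}:` (a locally finite sum; `r = k - ½`). -/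
def bestar (l : ℕ) (p q : Fin l) : BFock l → BFock l :=
  fun x => ∑ᶠ k : ℤ, nGam l true p (1 - k) false q k x

/-- `ê^{pq} = Σ_{r∈½+ℤ} :γ^{-,p}_{-r} γ^{-,q}_{r}:`. -/
def bee (l : ℕ) (p q : Fin l) : BFock l → BFock l :=
  fun x => ∑ᶠ k : ℤ, nGam l false p (1 - k) false q k x

/-- `ê**^{pq} = Σ_{r∈½+ℤ} :γ^{+,p}_{-r} γ^{+,q}_{r}:`. -/
def bestarstar (l : ℕ) (p q : Fin l) : BFock l → BFock l :=
  fun x => ∑ᶠ k : ℤ, nGam l true p (1 - k) true q k x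

/-- The polynomial `Γ⁺_i`: the determinant of the `i×i` matrix with `(a,b)` entry
`γ^{+,a}_{-b+½}` (all entries are multiplications by variables, which commute, so the
determinant operator is multiplication by the determinant of the matrix of variables). -/
def PPlus (l : ℕ) (i : ℕ) (h : i ≤ l) : BFock l :=
  (Matrix.of fun a b : Fin i =>
    MvPolynomial.X ((true, Fin.castLE h a, (b : ℕ)) : BBas l)).det

namespace Derivation

variable {R A : Type*} [CommRing R] [CommRing A] [Algebra R A]

theorem sum_apply {ι : Type*} (s : Finset ι) (D : ι → Derivation R A A) (a : A) :
    (∑ i ∈ s, D i) a = ∑ i ∈ s, D i a := by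
  classical
  induction s using Finset.induction_on with
  | empty => simp
  | insert i s hi ih => simp [Finset.sum_insert hi, ih]

theorem map_prod_eq_sum {ι : Type*} [DecidableEq ι] (D : Derivation R A A) (s : Finset ι)
    (f : ι → A) : D (∏ i ∈ s, f i) = ∑ i ∈ s, (∏ j ∈ s.erase i, f j) * D (f i) := by
  induction s using Finset.induction_on with
  | empty => simp
  | insert i s hi ih =>
    rw [Finset.prod_insert hi, Finset.sum_insert hi, D.leibniz, ih, Finset.erase_insert hi,
      add_comm, smul_eq_mul, smul_eq_mul, Finset.mul_sum]
    congr 1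
    refine Finset.sum_congr rfl fun j hj => ?_
    have hij : i ≠ j := fun h => hi (h ▸ hj)
    rw [Finset.erase_insert_of_ne hij,
      Finset.prod_insert fun h => hi (Finset.mem_of_mem_erase h), mul_assoc]

theorem map_det_eq_sum_updateRow {n : Type*} [Fintype n] [DecidableEq n]
    (D : Derivation R A A) (M : Matrix n n A) :
    D M.det = ∑ a, (M.updateRow a fun b => D (M a b)).det := by
  simp only [← Matrix.det_transpose M, ← Matrix.det_transpose (Matrix.updateRow _ _ _),
    Matrix.det_apply, map_sum]
  rw [Finset.sum_comm]
  refine Finset.sum_congr rfl fun σ _ => ?_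
  rw [← Finset.smul_sum, Units.smul_def, map_zsmul, Units.smul_def, map_prod_eq_sum]
  congr 1
  refine Finset.sum_congr rfl fun a _ => ?_
  rw [← Finset.mul_prod_erase Finset.univ _ (Finset.mem_univ a), mul_comm]
  congr 1
  · simp
  · refine Finset.prod_congr rfl fun b hb => ?_
    simp [Matrix.updateRow_ne (Finset.ne_of_mem_erase hb)]

theorem map_det_of_row {n : Type*} [Fintype n] [DecidableEq n]
    (D : Derivation R A A) (M : Matrix n n A) (p q : n)
    (h : ∀ a b, D (M a b) = if a = q then M p b else 0) :
    D M.det = if p = q then M.det else 0 := by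
  rw [D.map_det_eq_sum_updateRow, Finset.sum_eq_single q]
  · simp only [h, if_true]
    split_ifs with hpq
    · subst hpq
      rw [show (fun b => M p b) = M p from rfl, Matrix.updateRow_eq_self]
    · refine Matrix.det_zero_of_row_eq hpq ?_
      rw [Matrix.updateRow_self, Matrix.updateRow_ne hpq]
  · intro a _ ha
    refine Matrix.det_eq_zero_of_row_eq_zero a fun b => ?_
    simp [h, ha]
  · simp

theorem map_det_eq_zero {n : Type*} [Fintype n] [DecidableEq n]
    (D : Derivation R A A) (M : Matrix n n A) (h : ∀ a b, D (M a b) = 0) :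
    D M.det = 0 := by
  rw [D.map_det_eq_sum_updateRow]
  refine Finset.sum_eq_zero fun a _ => Matrix.det_eq_zero_of_row_eq_zero a fun b => ?_
  simp [h]

theorem map_prod_pow_of_eigen {ι : Type*} (D : Derivation R A A) (s : Finset ι)
    (f : ι → A) (e : ι → ℕ) (c : ι → R) (h : ∀ i ∈ s, D (f i) = c i • f i) :
    D (∏ i ∈ s, f i ^ e i) = (∑ i ∈ s, (e i : R) * c i) • ∏ i ∈ s, f i ^ e i := by
  classical
  induction s using Finset.induction_on with
  | empty => simp
  | insert i s hi ih =>
    have hpow : D (f i ^ e i) = ((e i : R) * c i) • f i ^ e i := by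
      rw [D.leibniz_pow, h i (Finset.mem_insert_self i s)]
      cases e i with
      | zero => simp
      | succ k =>
        simp only [Nat.add_sub_cancel, Algebra.smul_def (R := R), smul_eq_mul,
          map_mul, ← Nat.cast_smul_eq_nsmul R]
        ring
    rw [Finset.prod_insert hi, Finset.sum_insert hi, D.leibniz, hpow,
      ih fun j hj => h j (Finset.mem_insert_of_mem hj)]
    simp only [Algebra.smul_def (R := R), smul_eq_mul, map_add]
    ring

end Derivation

theorem sum_range_ite_sub {G : Type*} [AddCommGroup G] (f : ℕ → G) (r n : ℕ) :
    ∑ k ∈ Finset.range n, (if r ≤ k then f k - f (k + 1) else 0) = f r - f (max r n) := by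
  induction n with
  | zero => simp
  | succ n ih =>
    rw [Finset.sum_range_succ, ih]
    split_ifs with h
    · rw [max_eq_right h, max_eq_right (by omega)]
      abel
    · rw [max_eq_left (by omega), max_eq_left (by omega), add_zero]

theorem MvPolynomial.pderiv_comm_apply {σ R : Type*} [CommRing R] (i j : σ)
    (f : MvPolynomial σ R) : pderiv i (pderiv j f) = pderiv j (pderiv i f) := by
  classical
  have h : (⁅pderiv i, pderiv j⁆ : Derivation R (MvPolynomial σ R) (MvPolynomial σ R)) = 0 :=
    MvPolynomial.derivation_ext fun k => by
      rw [Derivation.commutator_apply]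
      simp [pderiv_X, Pi.single_apply, apply_ite]
  have := DFunLike.congr_fun h f
  rwa [Derivation.commutator_apply, Derivation.zero_apply, sub_eq_zero] at this

/-- The derivation `Σ_{n<N} x^{+,p}_n ∂/∂x^{+,q}_n`. -/
def rowDer (l N : ℕ) (p q : Fin l) : Derivation ℂ (BFock l) (BFock l) :=
  ∑ n ∈ Finset.range N, (MvPolynomial.X ((true, p, n) : BBas l) : BFock l) •
    MvPolynomial.pderiv ((true, q, n) : BBas l)

/-- The derivation `Σ_p x^{+,p}_a ∂/∂x^{+,p}_b`. -/
def colDer (l a b : ℕ) : Derivation ℂ (BFock l) (BFock l) :=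
  ∑ p : Fin l, (MvPolynomial.X ((true, p, a) : BBas l) : BFock l) •
    MvPolynomial.pderiv ((true, p, b) : BBas l)

theorem rowDer_apply (l N : ℕ) (p q : Fin l) (f : BFock l) :
    rowDer l N p q f = ∑ n ∈ Finset.range N, MvPolynomial.X ((true, p, n) : BBas l) *
      MvPolynomial.pderiv ((true, q, n) : BBas l) f := by
  rw [rowDer, Derivation.sum_apply]
  simp

theorem colDer_apply (l a b : ℕ) (f : BFock l) :
    colDer l a b f = ∑ p : Fin l, MvPolynomial.X ((true, p, a) : BBas l) *
      MvPolynomial.pderiv ((true, p, b) : BBas l) f := by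
  rw [colDer, Derivation.sum_apply]
  simp

theorem rowDer_X (l N : ℕ) (p q a : Fin l) (b : ℕ) (hb : b < N) :
    rowDer l N p q (MvPolynomial.X (true, a, b)) =
      if a = q then MvPolynomial.X (true, p, b) else 0 := by
  rw [rowDer_apply, Finset.sum_eq_single b]
  · rcases eq_or_ne a q with rfl | h
    · simp
    · simp [MvPolynomial.pderiv_X, h]
  · intro n _ hn
    simp [MvPolynomial.pderiv_X, hn.symm]
  · simp [hb]

theorem colDer_X (l a b : ℕ) (p : Fin l) (c : ℕ) :
    colDer l a b (MvPolynomial.X (true, p, c)) =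
      if c = b then MvPolynomial.X (true, p, a) else 0 := by
  rw [colDer_apply, Finset.sum_eq_single p]
  · by_cases h : c = b <;> simp [MvPolynomial.pderiv_X, h]
  · intro q _ hq
    simp [MvPolynomial.pderiv_X, hq.symm]
  · simp

theorem rowDer_PPlus (l : ℕ) (p q : Fin l) (hpq : p ≤ q) (i : ℕ) (h : i ≤ l) :
    rowDer l l p q (PPlus l i h) =
      (if p = q ∧ (q : ℕ) < i then (1 : ℂ) else 0) • PPlus l i h := by
  unfold PPlus
  by_cases hq : (q : ℕ) < i
  · have hp : (p : ℕ) < i := lt_of_le_of_lt hpq hq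
    rw [Derivation.map_det_of_row _ _ ⟨p, hp⟩ ⟨q, hq⟩]
    · by_cases he : p = q
      · simp [he, hq]
      · simp [he, Fin.val_ne_of_ne he]
    · intro a b
      rw [Matrix.of_apply, rowDer_X _ _ _ _ _ _ (by omega)]
      simp [Fin.ext_iff]
  · rw [Derivation.map_det_eq_zero]
    · simp [hq]
    · intro a b
      rw [Matrix.of_apply, rowDer_X _ _ _ _ _ _ (by omega), if_neg]
      intro he
      have := congrArg Fin.val he
      simp at this
      omega

theorem colDer_PPlus (l a b : ℕ) (hab : a ≤ b) (i : ℕ) (h : i ≤ l) :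
    colDer l a b (PPlus l i h) = (if a = b ∧ b < i then (1 : ℂ) else 0) • PPlus l i h := by
  unfold PPlus
  rw [← Matrix.det_transpose]
  by_cases hb : b < i
  · have ha : a < i := lt_of_le_of_lt hab hb
    rw [Derivation.map_det_of_row _ _ ⟨a, ha⟩ ⟨b, hb⟩]
    · by_cases he : a = b <;> simp [he, hb]
    · intro c d
      rw [Matrix.transpose_apply, Matrix.of_apply, colDer_X]
      simp [Fin.ext_iff]
  · rw [Derivation.map_det_eq_zero]
    · simp [hb]
    · intro c d
      rw [Matrix.transpose_apply, Matrix.of_apply, colDer_X, if_neg (by omega)]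

theorem pderiv_false_PPlus (l : ℕ) (p : Fin l) (n i : ℕ) (h : i ≤ l) :
    MvPolynomial.pderiv ((false, p, n) : BBas l) (PPlus l i h) = 0 :=
  Derivation.map_det_eq_zero _ _ fun a b => by simp [MvPolynomial.pderiv_X]

theorem pderiv_true_PPlus (l : ℕ) (p : Fin l) (n : ℕ) (hn : l ≤ n) (i : ℕ) (h : i ≤ l) :
    MvPolynomial.pderiv ((true, p, n) : BBas l) (PPlus l i h) = 0 :=
  Derivation.map_det_eq_zero _ _ fun a b => by
    have : (b : ℕ) ≠ n := by omega
    simp [MvPolynomial.pderiv_X, this]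

theorem boson_of_nonpos (l : ℕ) (ε : Bool) (p : Fin l) {k : ℤ} (hk : k ≤ 0) (f : BFock l) :
    boson l ε p k f = MvPolynomial.X ((ε, p, (-k).toNat) : BBas l) * f := by
  simp [boson, hk, gamCr]

theorem boson_true_of_pos (l : ℕ) (p : Fin l) {k : ℤ} (hk : 1 ≤ k) (f : BFock l) :
    boson l true p k f = MvPolynomial.pderiv ((false, p, (k - 1).toNat) : BBas l) f := by
  simp [boson, show ¬ k ≤ 0 by omega, gamAn]

theorem boson_false_of_pos (l : ℕ) (p : Fin l) {k : ℤ} (hk : 1 ≤ k) (f : BFock l) :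
    boson l false p k f = -MvPolynomial.pderiv ((true, p, (k - 1).toNat) : BBas l) f := by
  simp [boson, show ¬ k ≤ 0 by omega, gamAn]

theorem nGam_true_false_of_pos {l : ℕ} {v : BFock l}
    (hv : ∀ (p : Fin l) (n : ℕ), MvPolynomial.pderiv ((false, p, n) : BBas l) v = 0)
    (p q : Fin l) {j k : ℤ} (hj : 1 ≤ j) :
    nGam l true p j false q k v = 0 := by
  unfold nGam
  split_ifs with h
  · simp only [boson_true_of_pos l p hj, boson_of_nonpos l false q h.2, hv, mul_zero]
  · simp only [boson_true_of_pos l p hj, boson_false_of_pos l q (show 1 ≤ k by omega),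
      map_neg]
    rw [MvPolynomial.pderiv_comm_apply]
    simp [hv]

theorem bestarstar_eq_zero {l : ℕ} {v : BFock l}
    (hv : ∀ (p : Fin l) (n : ℕ), MvPolynomial.pderiv ((false, p, n) : BBas l) v = 0)
    (p q : Fin l) : bestarstar l p q v = 0 := by
  unfold bestarstar
  refine finsum_eq_zero_of_forall_eq_zero fun k => ?_
  unfold nGam
  split_ifs with h
  · simp only [boson_true_of_pos l p h.1, boson_of_nonpos l true q h.2, hv, mul_zero]
  · simp only [boson_true_of_pos l q (show 1 ≤ k by omega), hv,
      boson_of_nonpos l true p (show 1 - k ≤ 0 by omega), mul_zero]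

theorem bEhat_of_nonpos {l : ℕ} {v : BFock l}
    (hv : ∀ (p : Fin l) (n : ℕ), MvPolynomial.pderiv ((false, p, n) : BBas l) v = 0)
    {a : ℤ} (b : ℤ) (ha : a ≤ 0) : bEhat l a b v = 0 := by
  unfold bEhat
  simp [nGam_true_false_of_pos hv _ _ (show 1 ≤ 1 - a by omega)]

theorem nGam_true_false_succ {l : ℕ} (p q : Fin l) (a b : ℕ) (f : BFock l) :
    nGam l true p (1 - (a + 1 : ℕ)) false q (b + 1 : ℕ) f =
      -(MvPolynomial.X ((true, p, a) : BBas l) *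
        MvPolynomial.pderiv ((true, q, b) : BBas l) f) := by
  unfold nGam
  rw [if_neg (by omega)]
  simp only [boson_false_of_pos l q (show (1 : ℤ) ≤ (b + 1 : ℕ) by omega),
    boson_of_nonpos l true p (show (1 : ℤ) - (a + 1 : ℕ) ≤ 0 by omega),
    show (-(1 - ((a + 1 : ℕ) : ℤ))).toNat = a by omega,
    show (((b + 1 : ℕ) : ℤ) - 1).toNat = b by omega, mul_neg]

theorem bEhat_succ {l : ℕ} (a b : ℕ) (f : BFock l) :
    bEhat l (a + 1 : ℕ) (b + 1 : ℕ) f = colDer l a b f := by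
  unfold bEhat
  rw [colDer_apply, ← Finset.sum_neg_distrib]
  exact Finset.sum_congr rfl fun p _ => by rw [nGam_true_false_succ, neg_neg]

theorem bestar_eq_neg_rowDer {l N : ℕ} {v : BFock l}
    (hv : ∀ (p : Fin l) (n : ℕ), MvPolynomial.pderiv ((false, p, n) : BBas l) v = 0)
    (hN : ∀ (p : Fin l) (n : ℕ), N ≤ n → MvPolynomial.pderiv ((true, p, n) : BBas l) v = 0)
    (p q : Fin l) : bestar l p q v = -rowDer l N p q v := by
  have hinj : Function.Injective fun n : ℕ => ((n + 1 : ℕ) : ℤ) := fun a b h => by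
    simpa using h
  unfold bestar
  rw [finsum_eq_sum_of_support_subset (s := (Finset.range N).map ⟨_, hinj⟩), Finset.sum_map,
    rowDer_apply, ← Finset.sum_neg_distrib]
  · exact Finset.sum_congr rfl fun n _ => nGam_true_false_succ p q n n v
  · intro k hk
    by_cases h1 : k ≤ 0
    · exact absurd (nGam_true_false_of_pos hv p q (show 1 ≤ 1 - k by omega)) hk
    · obtain ⟨n, rfl⟩ : ∃ n : ℕ, k = (n + 1 : ℕ) := ⟨(k - 1).toNat, by omega⟩
      have hn : n < N := by
        by_contra hn
        refine hk ?_
        simp only [nGam_true_false_succ, hN q n (by omega), mul_zero, neg_zero]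
      simpa using hn

/-- for integers `m₁ ≥ … ≥ m_l ≥ 0` (with `m_k := 0` for `k > l`), the
vector `v = Γ^{+,m₁-m₂}_1 ⋯ Γ^{+,m_{l-1}-m_l}_{l-1} Γ^{+,m_l}_l |0⟩` is annihilated by the
`Ê_{ab}` (`a < b`), by the `ê*^{pq}` (`p < q`) and by all `ê**^{pq}`, and is an eigenvector
of `ê*^{pp}` with eigenvalue `-m_p` and of `Ê_{kk} - Ê_{1-k,1-k}` with eigenvalue `m_k`. -/
theorem hwvector_Sp_dinf_bosonic (l : ℕ) (hl : 1 ≤ l) (m : Fin l → ℤ)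
    (hm : ∀ p q : Fin l, p ≤ q → m q ≤ m p)
    (hnonneg : ∀ p : Fin l, 0 ≤ m p)
    (M : ℕ → ℤ)
    (hM : ∀ k : ℕ, M k = if h : 1 ≤ k ∧ k ≤ l then m ⟨k - 1, by omega⟩ else 0)
    (v : BFock l)
    (hv : v = ∏ k ∈ (Finset.range l).attach,
      PPlus l ((k : ℕ) + 1) (by have := Finset.mem_range.mp k.2; omega) ^
        ((M ((k : ℕ) + 1) - M ((k : ℕ) + 2)).toNat)) :
    (∀ a b : ℤ, a < b → bEhat l a b v = 0) ∧
    (∀ p q : Fin l, p < q → bestar l p q v = 0) ∧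
    (∀ p q : Fin l, bestarstar l p q v = 0) ∧
    (∀ p : Fin l, bestar l p p v = (-(m p) : ℂ) • v) ∧
    (∀ k : ℕ, 1 ≤ k →
      bEhat l (k : ℤ) (k : ℤ) v - bEhat l (1 - (k : ℤ)) (1 - (k : ℤ)) v = ((M k : ℂ)) • v) := by
  have hMpos : ∀ p : Fin l, M ((p : ℕ) + 1) = m p := fun p => by
    rw [hM, dif_pos (by omega)]
    rfl
  have hMzero : ∀ k, l < k → M k = 0 := fun k hk => by rw [hM, dif_neg (by omega)]
  have hMle : ∀ k, M (k + 2) ≤ M (k + 1) := fun k => by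
    by_cases h1 : k + 1 < l
    · rw [hMpos ⟨k + 1, h1⟩, hMpos ⟨k, by omega⟩]
      exact hm _ _ (Fin.mk_le_mk.mpr (by omega))
    · rw [hMzero (k + 2) (by omega)]
      by_cases h2 : k < l
      · rw [hMpos ⟨k, h2⟩]
        exact hnonneg _
      · rw [hMzero _ (by omega)]
  have heigen : ∀ (D : Derivation ℂ (BFock l) (BFock l)) (c : ℕ → ℂ),
      (∀ i (h : i ≤ l), D (PPlus l i h) = c i • PPlus l i h) →
      D v = (∑ k ∈ Finset.range l, ((M (k + 1) - M (k + 2) : ℤ) : ℂ) * c (k + 1)) • v := by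
    intro D c h
    rw [hv, D.map_prod_pow_of_eigen (Finset.range l).attach
      (fun k => PPlus l ((k : ℕ) + 1) (by have := Finset.mem_range.mp k.2; omega)) _
      (fun k => c ((k : ℕ) + 1)) fun k _ => h _ _, ← Finset.sum_attach (Finset.range l)]
    congr 1
    refine Finset.sum_congr rfl fun k _ => ?_
    rw [← Int.cast_natCast, Int.toNat_of_nonneg (sub_nonneg.mpr (hMle k))]
  have hkill : ∀ D : Derivation ℂ (BFock l) (BFock l),
      (∀ i (h : i ≤ l), D (PPlus l i h) = 0) → D v = 0 := fun D h => by
    rw [heigen D 0 fun i hi => by simp [h]]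
    simp
  have htel : ∀ r : ℕ, ∑ k ∈ Finset.range l, ((M (k + 1) - M (k + 2) : ℤ) : ℂ) *
      (if r < k + 1 then 1 else 0) = M (r + 1) := fun r => by
    have := sum_range_ite_sub (fun k => (M (k + 1) : ℂ)) r l
    rw [hMzero (max r l + 1) (by omega), Int.cast_zero, sub_zero] at this
    rw [← this]
    refine Finset.sum_congr rfl fun k _ => ?_
    simp
  have hminus : ∀ (p : Fin l) (n : ℕ),
      MvPolynomial.pderiv ((false, p, n) : BBas l) v = 0 := fun p n =>
    hkill _ fun i hi => pderiv_false_PPlus l p n i hi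
  have hplus : ∀ (p : Fin l) (n : ℕ), l ≤ n →
      MvPolynomial.pderiv ((true, p, n) : BBas l) v = 0 := fun p n hn =>
    hkill _ fun i hi => pderiv_true_PPlus l p n hn i hi
  refine ⟨fun a b hab => ?_, fun p q hpq => ?_, bestarstar_eq_zero hminus, fun p => ?_,
    fun k hk => ?_⟩
  · by_cases ha : a ≤ 0
    · exact bEhat_of_nonpos hminus b ha
    · obtain ⟨a, rfl⟩ : ∃ n : ℕ, a = (n + 1 : ℕ) := ⟨(a - 1).toNat, by omega⟩
      obtain ⟨b, rfl⟩ : ∃ n : ℕ, b = (n + 1 : ℕ) := ⟨(b - 1).toNat, by omega⟩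
      rw [bEhat_succ]
      refine hkill _ fun i hi => ?_
      rw [colDer_PPlus l a b (by omega), if_neg (by omega), zero_smul]
  · rw [bestar_eq_neg_rowDer hminus hplus, neg_eq_zero]
    refine hkill _ fun i hi => ?_
    rw [rowDer_PPlus l p q hpq.le, if_neg fun h => hpq.ne h.1, zero_smul]
  · rw [bestar_eq_neg_rowDer hminus hplus, heigen _ _ (rowDer_PPlus l p p le_rfl)]
    simp only [true_and]
    rw [htel, hMpos, neg_smul]
  · obtain ⟨k, rfl⟩ := Nat.exists_eq_add_of_le' hk
    rw [bEhat_of_nonpos (a := 1 - (k + 1 : ℕ)) hminus _ (by omega), sub_zero, bEhat_succ,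
      heigen _ _ (colDer_PPlus l k k le_rfl)]
    simp only [true_and]
    rw [htel]

end
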